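/- Let H = Σ_{w∈W} h_w be a Hamiltonian as a sum of n Hermitian local terms of operator norm at most 1, where each local term's support intersects the supports of at most m other local terms, and let ρ be a product density matrix with average energy ⟨H⟩_ρ = Tr(ρH). Then for every real a ≥ √(8em²/n), the weight Tr(ρ Π_{≥ ⟨H⟩_ρ + na}) of ρ on eigenvalues of H at least ⟨H⟩_ρ + na is at most exp(−na²/(4em²)). -/

import Mathlib

open Matrix
open scoped ComplexOrder

variable {C : Type*} [Fintype C] [DecidableEq C] {d : ℕ}

/-- An operator on the spins `C` (each carrying `ℂ^d`) is *supported on* the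
subset `w ⊆ C` if it acts as the identity on the tensor factors outside `w`:
its matrix entries vanish unless the configurations agree outside `w`, and they
depend only on the configuration inside `w`. -/
def SupportedOn (w : Finset C) (M : Matrix (C → Fin d) (C → Fin d) ℂ) : Prop :=
  (∀ x y, M x y ≠ 0 → ∀ s ∉ w, x s = y s) ∧
  (∀ x y x' y', (∀ s ∈ w, x s = x' s) → (∀ s ∈ w, y s = y' s) →
    (∀ s ∉ w, x s = y s) → (∀ s ∉ w, x' s = y' s) → M x y = M x' y')

/-- The product operator `⊗_{s ∈ C} ρ_s` on `⊗_{s ∈ C} ℂ^d`. -/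
def prodMatrix (ρs : C → Matrix (Fin d) (Fin d) ℂ) :
    Matrix (C → Fin d) (C → Fin d) ℂ :=
  fun x y => ∏ s, ρs s (x s) (y s)

/-- Operator (spectral) norm of a matrix. -/
noncomputable def opNorm {m : Type*} [Fintype m] [DecidableEq m]
    (M : Matrix m m ℂ) : ℝ :=
  ‖Matrix.toEuclideanCLM (𝕜 := ℂ) M‖

/-- Spectral projector of a Hermitian matrix `H` onto eigenvalues ≥ `f`. -/
noncomputable def projGE {m : Type*} [Fintype m] [DecidableEq m]
    {H : Matrix m m ℂ} (hH : H.IsHermitian) (f : ℝ) : Matrix m m ℂ :=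
  (hH.eigenvectorUnitary : Matrix m m ℂ) *
    Matrix.diagonal (fun i => if f ≤ hH.eigenvalues i then (1 : ℂ) else 0) *
    (star hH.eigenvectorUnitary : Matrix m m ℂ)

/-- Spectral projector of a Hermitian matrix `H` onto eigenvalues ≤ `f`. -/
noncomputable def projLE {m : Type*} [Fintype m] [DecidableEq m]
    {H : Matrix m m ℂ} (hH : H.IsHermitian) (f : ℝ) : Matrix m m ℂ :=
  (hH.eigenvectorUnitary : Matrix m m ℂ) *
    Matrix.diagonal (fun i => if hH.eigenvalues i ≤ f then (1 : ℂ) else 0) *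
    (star hH.eigenvectorUnitary : Matrix m m ℂ)

open scoped Matrix.Norms.L2Operator in
theorem opNorm_eq_l2 {m : Type*} [Fintype m] [DecidableEq m] (M : Matrix m m ℂ) :
    opNorm M = ‖M‖ := Matrix.l2_opNorm_toEuclideanCLM M

section Spectral

variable {ι : Type*} [Fintype ι] [DecidableEq ι]

/-- The diagonal operator with entries `f` in the eigenbasis of a Hermitian matrix. -/
noncomputable def eigenDiagonal {A : Matrix ι ι ℂ} (hA : A.IsHermitian) (f : ι → ℂ) :
    Matrix ι ι ℂ :=
  (hA.eigenvectorUnitary : Matrix ι ι ℂ) * Matrix.diagonal f *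
    (star hA.eigenvectorUnitary : Matrix ι ι ℂ)

theorem eigenDiagonal_eigenvalues {A : Matrix ι ι ℂ} (hA : A.IsHermitian) :
    eigenDiagonal hA (fun i => (hA.eigenvalues i : ℂ)) = A := by
  conv_rhs => rw [hA.spectral_theorem, Unitary.conjStarAlgAut_apply]
  rfl

theorem eigenDiagonal_const {A : Matrix ι ι ℂ} (hA : A.IsHermitian) (c : ℂ) :
    eigenDiagonal hA (fun _ => c) = c • 1 := by
  have hd : Matrix.diagonal (fun _ : ι => c) = c • (1 : Matrix ι ι ℂ) := by
    ext i j; simp [Matrix.diagonal_apply, Matrix.one_apply]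
  rw [eigenDiagonal, hd]
  simp

theorem eigenDiagonal_sub {A : Matrix ι ι ℂ} (hA : A.IsHermitian) (f g : ι → ℂ) :
    eigenDiagonal hA (f - g) = eigenDiagonal hA f - eigenDiagonal hA g := by
  simp only [eigenDiagonal, ← Matrix.sub_mul, ← Matrix.mul_sub]
  congr 2
  ext i j; by_cases h : i = j <;> simp [h]

theorem eigenDiagonal_pow {A : Matrix ι ι ℂ} (hA : A.IsHermitian) (f : ι → ℂ) (r : ℕ) :
    eigenDiagonal hA f ^ r = eigenDiagonal hA (f ^ r) := by
  have key (g : ι → ℂ) : eigenDiagonal hA g =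
      Unitary.conjStarAlgAut ℂ _ hA.eigenvectorUnitary (diagonal g) := rfl
  rw [key, key, ← map_pow, Matrix.diagonal_pow]

theorem exp_eigenDiagonal {A : Matrix ι ι ℂ} (hA : A.IsHermitian) (f : ι → ℂ) :
    NormedSpace.exp (eigenDiagonal hA f) = eigenDiagonal hA (fun i => Complex.exp (f i)) := by
  have hU : (star hA.eigenvectorUnitary : Matrix ι ι ℂ) * (hA.eigenvectorUnitary : Matrix ι ι ℂ)
      = 1 := Unitary.coe_star_mul_self _
  have hU' : (hA.eigenvectorUnitary : Matrix ι ι ℂ) * (star hA.eigenvectorUnitary : Matrix ι ι ℂ)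
      = 1 := Unitary.coe_mul_star_self _
  have hinv : (hA.eigenvectorUnitary : Matrix ι ι ℂ)⁻¹ =
      (star hA.eigenvectorUnitary : Matrix ι ι ℂ) := Matrix.inv_eq_right_inv hU'
  have hu : IsUnit (hA.eigenvectorUnitary : Matrix ι ι ℂ) := ⟨⟨_, _, hU', hU⟩, rfl⟩
  rw [eigenDiagonal, eigenDiagonal, ← hinv, Matrix.exp_conj _ _ hu, Matrix.exp_diagonal]
  congr 3
  ext i
  rw [Pi.coe_exp, Complex.exp_eq_exp_ℂ]

/-- Measuring a Hermitian operator in a state gives a probability distribution on its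
eigenvalues. -/
theorem exists_eigen_distribution {ρ A : Matrix ι ι ℂ} (hρ : ρ.PosSemidef) (htr : ρ.trace = 1)
    (hA : A.IsHermitian) :
    ∃ p : ι → ℝ, (∀ i, 0 ≤ p i) ∧ ∑ i, p i = 1 ∧
      ∀ f : ι → ℂ, (ρ * eigenDiagonal hA f).trace = ∑ i, (p i : ℂ) * f i := by
  set U : Matrix ι ι ℂ := (hA.eigenvectorUnitary : Matrix ι ι ℂ) with hUdef
  have hP : (Uᴴ * ρ * U).PosSemidef := hρ.conjTranspose_mul_mul_same U
  have hdiag (i : ι) : 0 ≤ (Uᴴ * ρ * U) i i := hP.diag_nonneg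
  have hre (i : ι) : ((((Uᴴ * ρ * U) i i).re : ℝ) : ℂ) = (Uᴴ * ρ * U) i i :=
    Complex.ext rfl (Complex.nonneg_iff.mp (hdiag i)).2
  have htrace (f : ι → ℂ) : (ρ * eigenDiagonal hA f).trace =
      ∑ i, ((((Uᴴ * ρ * U) i i).re : ℝ) : ℂ) * f i := by
    have : (ρ * eigenDiagonal hA f).trace = ((Uᴴ * ρ * U) * Matrix.diagonal f).trace := by
      rw [eigenDiagonal, ← hUdef, ← Matrix.mul_assoc, Matrix.trace_mul_comm]
      simp only [Matrix.mul_assoc]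
      rfl
    rw [this, Matrix.trace]
    simp [Matrix.mul_diagonal, hre]
  refine ⟨fun i => ((Uᴴ * ρ * U) i i).re, fun i => (Complex.nonneg_iff.mp (hdiag i)).1, ?_,
    htrace⟩
  have h1 := htrace (fun _ => 1)
  rw [eigenDiagonal_const, one_smul, Matrix.mul_one, htr] at h1
  have h2 : ((∑ i, ((Uᴴ * ρ * U) i i).re : ℝ) : ℂ) = 1 := by
    push_cast
    simpa using h1.symm
  exact_mod_cast h2

open scoped Matrix.Norms.L2Operator in
theorem abs_eigenvalues_le_opNorm {A : Matrix ι ι ℂ} (hA : A.IsHermitian) (i : ι) :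
    |hA.eigenvalues i| ≤ opNorm A := by
  have : Nonempty ι := ⟨i⟩
  rw [opNorm_eq_l2]
  have h2 : ((hA.eigenvalues i : ℝ) : ℂ) ∈ spectrum ℂ A := by
    rw [hA.spectrum_eq_image_range]; exact ⟨_, ⟨i, rfl⟩, rfl⟩
  have := spectrum.norm_le_norm_of_mem h2
  simpa using this

open scoped Matrix.Norms.L2Operator in
theorem norm_apply_le_l2_opNorm (A : Matrix ι ι ℂ) (i j : ι) : ‖A i j‖ ≤ ‖A‖ := by
  have h1 := Matrix.l2_opNorm_mulVec A (EuclideanSpace.single j (1 : ℂ))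
  rw [PiLp.norm_single, norm_one, mul_one] at h1
  refine le_trans ?_ h1
  have h2 := PiLp.norm_apply_le ((EuclideanSpace.equiv ι ℂ).symm
    (A *ᵥ (EuclideanSpace.single j (1 : ℂ)))) i
  simpa using h2

open scoped Matrix.Norms.L2Operator in
theorem norm_trace_mul_le_opNorm {ρ : Matrix ι ι ℂ} (hρ : ρ.PosSemidef) (htr : ρ.trace = 1)
    (A : Matrix ι ι ℂ) : ‖(ρ * A).trace‖ ≤ opNorm A := by
  rw [opNorm_eq_l2]
  have hH := hρ.isHermitian
  set U : Matrix ι ι ℂ := (hH.eigenvectorUnitary : Matrix ι ι ℂ) with hUdef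
  have hsum : ∑ i, hH.eigenvalues i = 1 := by
    have := hH.trace_eq_sum_eigenvalues
    have h1 : ((∑ i, hH.eigenvalues i : ℝ) : ℂ) = 1 := by
      push_cast
      exact this.symm.trans htr
    exact_mod_cast h1
  have htrace : (ρ * A).trace = ∑ i, (hH.eigenvalues i : ℂ) * (Uᴴ * A * U) i i := by
    conv_lhs => rw [← eigenDiagonal_eigenvalues hH, eigenDiagonal, ← hUdef, Matrix.mul_assoc,
      Matrix.mul_assoc, Matrix.trace_mul_comm, Matrix.mul_assoc]
    rw [Matrix.trace]
    simp only [Matrix.diag_apply, Matrix.diagonal_mul]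
    rfl
  have hentry (i : ι) : ‖(Uᴴ * A * U) i i‖ ≤ ‖A‖ := by
    refine (norm_apply_le_l2_opNorm _ i i).trans (le_of_eq ?_)
    rw [hUdef, CStarRing.norm_mul_coe_unitary]
    exact CStarRing.norm_coe_unitary_mul (star hH.eigenvectorUnitary) A
  calc ‖(ρ * A).trace‖ ≤ ∑ i, ‖(hH.eigenvalues i : ℂ) * (Uᴴ * A * U) i i‖ := by
        rw [htrace]; exact norm_sum_le _ _
    _ ≤ ∑ i, hH.eigenvalues i * ‖A‖ := by
        refine Finset.sum_le_sum fun i _ => ?_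
        rw [norm_mul, Complex.norm_real, Real.norm_of_nonneg (hρ.eigenvalues_nonneg i)]
        exact mul_le_mul_of_nonneg_left (hentry i) (hρ.eigenvalues_nonneg i)
    _ = ‖A‖ := by rw [← Finset.sum_mul, hsum, one_mul]

end Spectral

section Product

open scoped Kronecker

theorem prodMatrix_mul (A B : C → Matrix (Fin d) (Fin d) ℂ) :
    prodMatrix A * prodMatrix B = prodMatrix (fun s => A s * B s) := by
  ext x y
  simp only [prodMatrix, Matrix.mul_apply, Finset.prod_univ_sum, Fintype.piFinset_univ,
    Finset.prod_mul_distrib]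

omit [DecidableEq C] in
theorem conjTranspose_prodMatrix (A : C → Matrix (Fin d) (Fin d) ℂ) :
    (prodMatrix A)ᴴ = prodMatrix (fun s => (A s)ᴴ) := by
  ext x y
  simp [prodMatrix, Matrix.conjTranspose_apply]

theorem trace_prodMatrix (A : C → Matrix (Fin d) (Fin d) ℂ) :
    (prodMatrix A).trace = ∏ s, (A s).trace := by
  simp only [prodMatrix, Matrix.trace, Matrix.diag_apply, Finset.prod_univ_sum,
    Fintype.piFinset_univ]

open scoped Matrix.Norms.L2Operator MatrixOrder in
theorem posSemidef_prodMatrix {ρs : C → Matrix (Fin d) (Fin d) ℂ}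
    (hρs : ∀ s, (ρs s).PosSemidef) : (prodMatrix ρs).PosSemidef := by
  have hex (s : C) : ∃ B : Matrix (Fin d) (Fin d) ℂ, ρs s = Bᴴ * B :=
    CStarAlgebra.nonneg_iff_eq_star_mul_self.mp (hρs s).nonneg
  choose B hB using hex
  have : prodMatrix ρs = (prodMatrix B)ᴴ * prodMatrix B := by
    rw [conjTranspose_prodMatrix, prodMatrix_mul]
    congr 1
    ext1 s
    exact hB s
  rw [this]
  exact Matrix.posSemidef_conjTranspose_mul_self _

/-- Splitting a configuration into its restrictions to `w` and to the complement of `w`. -/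
def configSplit (d : ℕ) (w : Finset C) :
    (C → Fin d) ≃ ({s // s ∈ w} → Fin d) × ({s // s ∉ w} → Fin d) :=
  Equiv.piEquivPiSubtypeProd (· ∈ w) (fun _ => Fin d)

/-- The operator `A ⊗ B` with `A` acting on the spins in `w` and `B` on the others. -/
def tensorOp (w : Finset C) (A : Matrix ({s // s ∈ w} → Fin d) ({s // s ∈ w} → Fin d) ℂ)
    (B : Matrix ({s // s ∉ w} → Fin d) ({s // s ∉ w} → Fin d) ℂ) :
    Matrix (C → Fin d) (C → Fin d) ℂ :=
  (A ⊗ₖ B).submatrix (configSplit d w) (configSplit d w)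

omit [Fintype C] in
theorem tensorOp_apply (w : Finset C)
    (A : Matrix ({s // s ∈ w} → Fin d) ({s // s ∈ w} → Fin d) ℂ)
    (B : Matrix ({s // s ∉ w} → Fin d) ({s // s ∉ w} → Fin d) ℂ) (x y : C → Fin d) :
    tensorOp w A B x y =
      A (fun s => x s) (fun s => y s) * B (fun s => x s) (fun s => y s) := rfl

theorem tensorOp_mul (w : Finset C)
    (A A' : Matrix ({s // s ∈ w} → Fin d) ({s // s ∈ w} → Fin d) ℂ)
    (B B' : Matrix ({s // s ∉ w} → Fin d) ({s // s ∉ w} → Fin d) ℂ) :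
    tensorOp w A B * tensorOp w A' B' = tensorOp w (A * A') (B * B') := by
  rw [tensorOp, tensorOp, Matrix.submatrix_mul_equiv, ← Matrix.mul_kronecker_mul, tensorOp]

theorem tensorOp_one (w : Finset C) :
    tensorOp w (1 : Matrix ({s // s ∈ w} → Fin d) ({s // s ∈ w} → Fin d) ℂ) 1 = 1 := by
  rw [tensorOp, Matrix.one_kronecker_one, Matrix.submatrix_one_equiv]

theorem trace_tensorOp (w : Finset C)
    (A : Matrix ({s // s ∈ w} → Fin d) ({s // s ∈ w} → Fin d) ℂ)
    (B : Matrix ({s // s ∉ w} → Fin d) ({s // s ∉ w} → Fin d) ℂ) :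
    (tensorOp w A B).trace = A.trace * B.trace := by
  rw [← Matrix.trace_kronecker, tensorOp]
  exact Equiv.sum_comp (configSplit d w) fun p => (A ⊗ₖ B) p p

theorem prodMatrix_eq_tensorOp (ρs : C → Matrix (Fin d) (Fin d) ℂ) (w : Finset C) :
    prodMatrix ρs = tensorOp w (prodMatrix fun s => ρs s) (prodMatrix fun s => ρs s) := by
  ext x y
  simp only [tensorOp_apply, prodMatrix]
  convert (Fintype.prod_subtype_mul_prod_subtype (· ∈ w) fun s => ρs s (x s) (y s)).symm

/-- The algebra of operators acting only on the spins in `w`. -/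
def opsOn (d : ℕ) (w : Finset C) : Subalgebra ℂ (Matrix (C → Fin d) (C → Fin d) ℂ) where
  carrier := {M | ∃ A, M = tensorOp w A 1}
  mul_mem' := by
    rintro _ _ ⟨A, rfl⟩ ⟨A', rfl⟩
    exact ⟨A * A', by rw [tensorOp_mul, mul_one]⟩
  add_mem' := by
    rintro _ _ ⟨A, rfl⟩ ⟨A', rfl⟩
    exact ⟨A + A', by rw [tensorOp, tensorOp, tensorOp, Matrix.add_kronecker]; rfl⟩
  algebraMap_mem' c := ⟨c • 1, by
    rw [tensorOp, Matrix.smul_kronecker, Matrix.submatrix_smul, Algebra.algebraMap_eq_smul_one,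
      ← tensorOp_one w, tensorOp]; rfl⟩

/-- The algebra of operators acting trivially on the spins in `w`. -/
def opsOff (d : ℕ) (w : Finset C) : Subalgebra ℂ (Matrix (C → Fin d) (C → Fin d) ℂ) where
  carrier := {M | ∃ B, M = tensorOp w 1 B}
  mul_mem' := by
    rintro _ _ ⟨B, rfl⟩ ⟨B', rfl⟩
    exact ⟨B * B', by rw [tensorOp_mul, mul_one]⟩
  add_mem' := by
    rintro _ _ ⟨B, rfl⟩ ⟨B', rfl⟩
    exact ⟨B + B', by rw [tensorOp, tensorOp, tensorOp, Matrix.kronecker_add]; rfl⟩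
  algebraMap_mem' c := ⟨c • 1, by
    rw [tensorOp, Matrix.kronecker_smul, Matrix.submatrix_smul, Algebra.algebraMap_eq_smul_one,
      ← tensorOp_one w, tensorOp]; rfl⟩

theorem commute_of_mem_opsOn_of_mem_opsOff {w : Finset C}
    {X Y : Matrix (C → Fin d) (C → Fin d) ℂ} (hX : X ∈ opsOn d w) (hY : Y ∈ opsOff d w) :
    Commute X Y := by
  obtain ⟨A, rfl⟩ := hX
  obtain ⟨B, rfl⟩ := hY
  rw [Commute, SemiconjBy, tensorOp_mul, tensorOp_mul, one_mul, mul_one, one_mul, mul_one]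

theorem trace_prodMatrix_mul_mul {ρs : C → Matrix (Fin d) (Fin d) ℂ}
    (hρs : ∀ s, (ρs s).trace = 1) {w : Finset C} {X Y : Matrix (C → Fin d) (C → Fin d) ℂ}
    (hX : X ∈ opsOn d w) (hY : Y ∈ opsOff d w) :
    (prodMatrix ρs * (X * Y)).trace = (prodMatrix ρs * X).trace * (prodMatrix ρs * Y).trace := by
  obtain ⟨A, rfl⟩ := hX
  obtain ⟨B, rfl⟩ := hY
  rw [prodMatrix_eq_tensorOp ρs w]
  simp only [tensorOp_mul, trace_tensorOp, mul_one, one_mul, trace_prodMatrix, hρs,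
    Finset.prod_const_one]

theorem isClosed_opsOn (w : Finset C) :
    IsClosed (opsOn d w : Set (Matrix (C → Fin d) (C → Fin d) ℂ)) :=
  Submodule.closed_of_finiteDimensional (Subalgebra.toSubmodule (opsOn d w))

theorem isClosed_opsOff (w : Finset C) :
    IsClosed (opsOff d w : Set (Matrix (C → Fin d) (C → Fin d) ℂ)) :=
  Submodule.closed_of_finiteDimensional (Subalgebra.toSubmodule (opsOff d w))

omit [Fintype C] in
theorem SupportedOn.mono {v w : Finset C} {M : Matrix (C → Fin d) (C → Fin d) ℂ}
    (hM : SupportedOn v M) (hvw : v ⊆ w) : SupportedOn w M := by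
  refine ⟨fun x y hxy s hs => hM.1 x y hxy s fun hv => hs (hvw hv), ?_⟩
  intro x y x' y' hx hy hxy hxy'
  by_cases hv : ∀ s ∉ v, x s = y s
  · refine hM.2 x y x' y' (fun s hs => hx s (hvw hs)) (fun s hs => hy s (hvw hs)) hv ?_
    intro s hs
    by_cases hw : s ∈ w
    · rw [← hx s hw, ← hy s hw, hv s hs]
    · exact hxy' s hw
  · have h0 : M x y = 0 := by
      by_contra hne
      exact hv (hM.1 x y hne)
    have h0' : M x' y' = 0 := by
      by_contra hne
      refine hv fun s hs => ?_
      by_cases hw : s ∈ w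
      · rw [hx s hw, hy s hw, hM.1 x' y' hne s hs]
      · exact hxy s hw
    rw [h0, h0']

theorem SupportedOn.mem_opsOn {w : Finset C} {M : Matrix (C → Fin d) (C → Fin d) ℂ}
    (hM : SupportedOn w M) : M ∈ opsOn d w := by
  rcases isEmpty_or_nonempty (C → Fin d) with hemp | ⟨⟨z⟩⟩
  · exact (Subsingleton.elim 0 M) ▸ zero_mem _
  refine ⟨Matrix.of fun x x' => M ((configSplit d w).symm (x, fun s => z s))
    ((configSplit d w).symm (x', fun s => z s)), ?_⟩
  ext x y
  rw [tensorOp_apply, Matrix.of_apply, Matrix.one_apply]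
  by_cases hxy : ∀ s ∉ w, x s = y s
  · rw [if_pos (by ext1 s; exact hxy s s.2), mul_one]
    refine hM.2 _ _ _ _ ?_ ?_ hxy ?_ <;> intro s hs <;>
      simp [configSplit, Equiv.piEquivPiSubtypeProd, hs]
  · rw [if_neg (fun he => hxy fun s hs => congr_fun he ⟨s, hs⟩), mul_zero]
    by_contra hne
    exact hxy (hM.1 x y hne)

theorem SupportedOn.mem_opsOff {v w : Finset C} {M : Matrix (C → Fin d) (C → Fin d) ℂ}
    (hM : SupportedOn v M) (hvw : Disjoint v w) : M ∈ opsOff d w := by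
  rcases isEmpty_or_nonempty (C → Fin d) with hemp | ⟨⟨z⟩⟩
  · exact (Subsingleton.elim 0 M) ▸ zero_mem _
  have hM' : SupportedOn wᶜ M :=
    hM.mono fun s hs => Finset.mem_compl.mpr (Finset.disjoint_left.mp hvw hs)
  refine ⟨Matrix.of fun x x' => M ((configSplit d w).symm (fun s => z s, x))
    ((configSplit d w).symm (fun s => z s, x')), ?_⟩
  ext x y
  rw [tensorOp_apply, Matrix.of_apply, Matrix.one_apply]
  by_cases hxy : ∀ s ∉ wᶜ, x s = y s
  · rw [if_pos (by ext1 s; exact hxy s (by simp [s.2])), one_mul]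
    refine hM'.2 _ _ _ _ ?_ ?_ hxy ?_ <;> intro s hs <;> rw [Finset.mem_compl] at hs <;>
      simp [configSplit, Equiv.piEquivPiSubtypeProd, hs]
    simp_all
  · rw [if_neg (fun he => hxy fun s hs => congr_fun he ⟨s, by simpa using hs⟩), zero_mul]
    by_contra hne
    exact hxy (hM'.1 x y hne)

end Product

section Counting

/-- Every letter of the word `l` lies in `P` or is related to a letter in another position. -/
def Clustered {α : Type*} (R : α → α → Prop) (P : Finset α) {r : ℕ} (l : Fin r → α) : Prop :=
  ∀ i, l i ∈ P ∨ ∃ j, j ≠ i ∧ R (l i) (l j)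

/-- Recursive bound on the number of clustered words of a given length. -/
def wordBound (m K : ℕ) : ℕ → ℕ → ℕ
  | 0, _ => 1
  | 1, b => b * m
  | r + 2, b => b * m * wordBound m K (r + 1) (b + 1) + (r + 1) * K * wordBound m K r (b + 2)

theorem wordBound_succ (m K r b : ℕ) : wordBound m K (r + 1) b =
    b * m * wordBound m K r (b + 1) + r * K * wordBound m K (r - 1) (b + 2) := by
  cases r <;> simp [wordBound]

variable {α : Type*} [Fintype α] [DecidableEq α] {R : α → α → Prop} [DecidableRel R]

theorem Clustered.removeNth (hsymm : ∀ a b, R a b → R b a) {P : Finset α} {r : ℕ}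
    {l : Fin (r + 1) → α} (hl : Clustered R P l) (k : Fin (r + 1)) :
    Clustered R (P ∪ Finset.univ.filter (R (l k))) (k.removeNth l) := by
  intro i
  rcases hl (k.succAbove i) with h | ⟨j, hj, hR⟩
  · exact Or.inl (Finset.mem_union_left _ h)
  · rcases Fin.eq_self_or_eq_succAbove k j with rfl | ⟨j', rfl⟩
    · exact Or.inl (Finset.mem_union_right _
        (Finset.mem_filter.mpr ⟨Finset.mem_univ _, hsymm _ _ hR⟩))
    · exact Or.inr ⟨j', fun h => hj (by rw [h]), hR⟩

open Classical in
/-- A set `P` swallowing neighbourhoods of `b` letters has at most `b * m` elements, which bounds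
the number of words clustered relative to `P`. -/
theorem card_clustered_le (hrefl : ∀ a, R a a) (hsymm : ∀ a b, R a b → R b a) {m : ℕ}
    (hm1 : 1 ≤ m) (hm : ∀ a, (Finset.univ.filter (R a)).card ≤ m + 1) :
    ∀ (r b : ℕ) (P : Finset α), P.card ≤ b * m →
      (Finset.univ.filter fun l : Fin r → α => Clustered R P l).card ≤
        wordBound m (Fintype.card α * (m + 1)) r b := by
  have hgrow (P : Finset α) (b : ℕ) (hP : P.card ≤ b * m) (a : α) (ha : a ∈ P) :
      (P ∪ Finset.univ.filter (R a)).card ≤ (b + 1) * m := by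
    have h1 := Finset.card_union_add_card_inter P (Finset.univ.filter (R a))
    have h2 : 1 ≤ (P ∩ Finset.univ.filter (R a)).card :=
      Finset.card_pos.mpr ⟨a, by simp [ha, hrefl a]⟩
    have h3 := hm a
    rw [add_mul, one_mul]
    omega
  have hgrow2 (P : Finset α) (b : ℕ) (hP : P.card ≤ b * m) (a a' : α) (haa' : R a a') :
      (P ∪ Finset.univ.filter (R a) ∪ Finset.univ.filter (R a')).card ≤ (b + 2) * m := by
    have h1 := Finset.card_union_add_card_inter (Finset.univ.filter (R a))
      (Finset.univ.filter (R a'))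
    have h2 := hm a
    have h3 := hm a'
    have h4 := Finset.card_union_le P (Finset.univ.filter (R a) ∪ Finset.univ.filter (R a'))
    rw [Finset.union_assoc, add_mul]
    by_cases h : a = a'
    · subst h
      rw [Finset.union_self] at h4 ⊢
      omega
    · have h5 : ({a, a'} : Finset α) ⊆
          Finset.univ.filter (R a) ∩ Finset.univ.filter (R a') := by
        intro x hx
        rcases Finset.mem_insert.mp hx with rfl | hx
        · simp [hrefl, hsymm _ _ haa']
        · rw [Finset.mem_singleton] at hx
          subst hx
          simp [hrefl, haa']
      have h6 := Finset.card_le_card h5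
      rw [Finset.card_pair h] at h6
      omega
  have hstep (r b : ℕ) (P : Finset α) (hP : P.card ≤ b * m)
      (ih : ∀ Q : Finset α, Q.card ≤ (b + 1) * m →
        (Finset.univ.filter fun l : Fin r → α => Clustered R Q l).card ≤
          wordBound m (Fintype.card α * (m + 1)) r (b + 1)) :
      (P.biUnion fun a => (Finset.univ.filter fun l : Fin r → α =>
        Clustered R (P ∪ Finset.univ.filter (R a)) l).image
          (fun l => Fin.insertNth (α := fun _ => α) 0 a l)).card ≤
      b * m * wordBound m (Fintype.card α * (m + 1)) r (b + 1) := by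
    refine (Finset.card_biUnion_le_card_mul _ _ _ fun a ha => ?_).trans
      (Nat.mul_le_mul_right _ hP)
    exact Finset.card_image_le.trans (ih _ (hgrow P b hP a ha))
  have hhead {r b : ℕ} {P : Finset α} {l : Fin (r + 1) → α} (hl : Clustered R P l)
      (h0 : l 0 ∈ P) : l ∈ P.biUnion fun a => (Finset.univ.filter fun l : Fin r → α =>
        Clustered R (P ∪ Finset.univ.filter (R a)) l).image
          (fun l => Fin.insertNth (α := fun _ => α) 0 a l) :=
    Finset.mem_biUnion.mpr ⟨l 0, h0, Finset.mem_image.mpr ⟨Fin.removeNth 0 l,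
      by simpa using hl.removeNth hsymm 0,
      Fin.insertNth_self_removeNth (α := fun _ => α) 0 l⟩⟩
  intro r
  induction r using Nat.strong_induction_on with
  | _ r ih =>
  intro b P hP
  match r, ih with
  | 0, _ => exact (Finset.card_le_univ _).trans (by simp [wordBound])
  | 1, ih =>
    refine (Finset.card_le_card ?_).trans ((hstep 0 b P hP (ih 0 one_pos _)).trans
      (by simp [wordBound]))
    intro l hl
    have hl' : Clustered R P l := by simpa using hl
    rcases hl' 0 with h | ⟨j, hj, -⟩
    · exact hhead (b := b) hl' h
    · exact absurd (Subsingleton.elim j 0) hj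
  | r + 2, ih =>
    have hpair : (Finset.univ.biUnion fun j : Fin (r + 1) => Finset.univ.biUnion fun a : α =>
        (Finset.univ.filter (R a)).biUnion fun a' =>
        (Finset.univ.filter fun l : Fin r → α =>
          Clustered R (P ∪ Finset.univ.filter (R a) ∪ Finset.univ.filter (R a')) l).image
          (fun l => Fin.insertNth (α := fun _ => α) 0 a
            (Fin.insertNth (α := fun _ => α) j a' l))).card ≤
        (r + 1) * (Fintype.card α * (m + 1)) *
          wordBound m (Fintype.card α * (m + 1)) r (b + 2) := by
      rw [mul_assoc, mul_assoc]
      refine (Finset.card_biUnion_le_card_mul _ _ _ fun j _ => ?_).trans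
        (Nat.mul_le_mul_right _ (by simp))
      refine (Finset.card_biUnion_le_card_mul _ _ _ fun a _ => ?_).trans
        (Nat.mul_le_mul_right _ (by simp))
      refine (Finset.card_biUnion_le_card_mul _ _ _ fun a' ha' => ?_).trans
        (Nat.mul_le_mul_right _ (hm a))
      exact Finset.card_image_le.trans (ih r (by omega) _ _
        (hgrow2 P b hP a a' (by simpa using ha')))
    refine le_trans (Finset.card_le_card ?_) ((Finset.card_union_le _ _).trans
      (Nat.add_le_add (hstep (r + 1) b P hP (ih (r + 1) (by omega) _)) hpair))
    intro l hl
    have hl' : Clustered R P l := by simpa using hl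
    rcases hl' 0 with h | ⟨j, hj, hR⟩
    · exact Finset.mem_union_left _ (hhead (b := b) hl' h)
    · obtain ⟨k, rfl⟩ := Fin.exists_succ_eq.mpr hj
      refine Finset.mem_union_right _ ?_
      simp only [Finset.mem_biUnion, Finset.mem_image, Finset.mem_filter, Finset.mem_univ,
        true_and]
      refine ⟨k, l 0, l k.succ, hR, k.removeNth (Fin.removeNth 0 l),
        (hl'.removeNth hsymm 0).removeNth hsymm k, ?_⟩
      have h1 := Fin.insertNth_self_removeNth (α := fun _ => α) k (Fin.removeNth 0 l)
      have h2 := Fin.insertNth_self_removeNth (α := fun _ => α) 0 l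
      exact (congrArg (Fin.insertNth (α := fun _ => α) 0 (l 0)) h1).trans h2

end Counting

section GeneratingFunction

theorem hasDerivAt_wordBound_sum (m K N b : ℕ) (t : ℝ) :
    HasDerivAt (fun x : ℝ => ∑ r ∈ Finset.range (N + 1), wordBound m K r b * x ^ r / r.factorial)
      (b * m * (∑ r ∈ Finset.range N, wordBound m K r (b + 1) * t ^ r / r.factorial) +
        K * t * ∑ r ∈ Finset.range (N - 1), wordBound m K r (b + 2) * t ^ r / r.factorial) t := by
  have h1 : HasDerivAt
      (fun x : ℝ => ∑ r ∈ Finset.range (N + 1), wordBound m K r b * x ^ r / r.factorial)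
      (∑ r ∈ Finset.range (N + 1), wordBound m K r b * (r * t ^ (r - 1)) / r.factorial) t :=
    HasDerivAt.fun_sum fun r _ => ((hasDerivAt_pow r t).const_mul _).div_const _
  convert h1 using 1
  rw [Finset.sum_range_succ']
  simp only [Nat.cast_zero, zero_mul, mul_zero, zero_div, add_zero, Nat.add_sub_cancel]
  have h2 (r : ℕ) : (wordBound m K (r + 1) b : ℝ) * (((r + 1 : ℕ) : ℝ) * t ^ r) /
      ((r + 1).factorial : ℝ) = b * m * (wordBound m K r (b + 1) * t ^ r / r.factorial) +
      K * (r * wordBound m K (r - 1) (b + 2) * t ^ r / r.factorial) := by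
    rw [wordBound_succ, Nat.factorial_succ]
    push_cast
    have : (r.factorial : ℝ) ≠ 0 := by positivity
    have : (r : ℝ) + 1 ≠ 0 := by positivity
    field_simp
  rw [Finset.sum_congr rfl fun r _ => h2 r, Finset.sum_add_distrib, ← Finset.mul_sum,
    ← Finset.mul_sum]
  congr 1
  rw [mul_assoc]
  congr 1
  cases N with
  | zero => simp
  | succ N =>
    rw [Finset.sum_range_succ']
    simp only [Nat.cast_zero, zero_mul, zero_div, add_zero, Nat.add_sub_cancel]
    rw [Finset.mul_sum]
    refine Finset.sum_congr rfl fun r _ => ?_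
    rw [Nat.factorial_succ]
    push_cast
    have : (r.factorial : ℝ) ≠ 0 := by positivity
    have : (r : ℝ) + 1 ≠ 0 := by positivity
    field_simp
    ring

theorem wordBound_sum_le (m K : ℕ) {T : ℝ} (hT : m * T ≤ 3 / 10) :
    ∀ (N b : ℕ), ∀ t ∈ Set.Icc 0 T,
      ∑ r ∈ Finset.range N, (wordBound m K r b : ℝ) * t ^ r / r.factorial ≤
        Real.exp (10 / 17 * K * (t ^ 2 / (1 - m * t))) * ((1 - m * t)⁻¹) ^ b := by
  intro N
  induction N using Nat.strong_induction_on with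
  | _ N ih =>
  intro b
  have hpos {t : ℝ} (ht : t ∈ Set.Icc 0 T) : 7 / 10 ≤ 1 - m * t := by
    have := mul_le_mul_of_nonneg_left ht.2 (Nat.cast_nonneg (α := ℝ) m)
    linarith
  cases N with
  | zero =>
    intro t ht
    have := hpos ht
    simp only [Finset.range_zero, Finset.sum_empty]
    have : 0 < 1 - m * t := by linarith
    positivity
  | succ N =>
    have hderiv {t : ℝ} (ht : t ∈ Set.Icc 0 T) : HasDerivAt
        (fun t : ℝ => Real.exp (10 / 17 * K * (t ^ 2 / (1 - m * t))) * ((1 - m * t)⁻¹) ^ b)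
        (Real.exp (10 / 17 * K * (t ^ 2 / (1 - m * t))) *
          (b * m * ((1 - m * t)⁻¹) ^ (b + 1) +
            10 / 17 * K * (2 * t - m * t ^ 2) * ((1 - m * t)⁻¹) ^ (b + 2))) t := by
      have hne : 1 - m * t ≠ 0 := by linarith [hpos ht]
      have hlin : HasDerivAt (fun t : ℝ => 1 - m * t) (-(m : ℝ)) t := by
        simpa using ((hasDerivAt_id t).const_mul (m : ℝ)).const_sub 1
      have hquot := (((hasDerivAt_pow 2 t).fun_div hlin hne).const_mul (10 / 17 * (K : ℝ))).exp
      have hinv := (hlin.fun_inv hne).fun_pow b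
      refine (hquot.fun_mul hinv).congr_deriv ?_
      cases b with
      | zero =>
        simp
        field_simp
        ring
      | succ b =>
        simp only [add_tsub_cancel_right]
        push_cast
        simp only [div_eq_mul_inv, ← inv_pow]
        generalize (1 - m * t)⁻¹ = q
        ring
    refine image_le_of_deriv_right_le_deriv_boundary
      (f' := fun t => b * m * (∑ r ∈ Finset.range N, wordBound m K r (b + 1) * t ^ r / r.factorial) +
        K * t * ∑ r ∈ Finset.range (N - 1), wordBound m K r (b + 2) * t ^ r / r.factorial)
      (fun t _ => (hasDerivAt_wordBound_sum m K N b t).continuousAt.continuousWithinAt)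
      (fun t _ => (hasDerivAt_wordBound_sum m K N b t).hasDerivWithinAt) ?_
      (fun t ht => (hderiv ht).continuousAt.continuousWithinAt)
      (fun t ht => (hderiv (Set.Ico_subset_Icc_self ht)).hasDerivWithinAt) ?_
    · rw [Finset.sum_range_succ']
      simp [wordBound]
    · intro t ht
      have ht' := Set.Ico_subset_Icc_self ht
      have hq := hpos ht'
      have hq0 : 0 < 1 - m * t := by linarith
      have h1 := ih N (by omega) (b + 1) t ht'
      have h2 := ih (N - 1) (by omega) (b + 2) t ht'
      have ht0 : 0 ≤ t := ht.1
      refine (add_le_add (mul_le_mul_of_nonneg_left h1 (by positivity))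
        (mul_le_mul_of_nonneg_left h2 (by positivity))).trans ?_
      have h3 : t ≤ 10 / 17 * (2 * t - m * t ^ 2) := by nlinarith
      have h4 : K * t * (Real.exp (10 / 17 * K * (t ^ 2 / (1 - m * t))) *
          ((1 - m * t)⁻¹) ^ (b + 2)) ≤ K * (10 / 17 * (2 * t - m * t ^ 2)) *
          (Real.exp (10 / 17 * K * (t ^ 2 / (1 - m * t))) * ((1 - m * t)⁻¹) ^ (b + 2)) := by
        gcongr
      linarith

end GeneratingFunction

section Moments

theorem sum_pow_eq_sum_words {α S : Type*} [Fintype α] [Semiring S] (g : α → S) (r : ℕ) :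
    (∑ a, g a) ^ r = ∑ l : Fin r → α, (List.ofFn fun i => g (l i)).prod := by
  induction r with
  | zero => simp
  | succ r ih =>
    rw [pow_succ', ih, Finset.sum_mul_sum, ← Fintype.sum_prod_type']
    refine Fintype.sum_equiv (Fin.consEquiv fun _ => α) _ _ fun p => ?_
    simp [List.ofFn_succ, Fin.consEquiv]

theorem exists_prod_ofFn_eq_mul {w : Finset C} {r : ℕ}
    {f : Fin r → Matrix (C → Fin d) (C → Fin d) ℂ} {i : Fin r} (hi : f i ∈ opsOn d w)
    (hf : ∀ j, j ≠ i → f j ∈ opsOff d w) :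
    ∃ Y ∈ opsOff d w, (List.ofFn f).prod = f i * Y := by
  induction r with
  | zero => exact i.elim0
  | succ r ih =>
    rw [List.ofFn_succ, List.prod_cons]
    cases i using Fin.cases with
    | zero =>
      refine ⟨_, Subalgebra.list_prod_mem _ fun x hx => ?_, rfl⟩
      obtain ⟨j, rfl⟩ := List.mem_ofFn.mp hx
      exact hf _ (Fin.succ_ne_zero j)
    | succ i =>
      obtain ⟨Y, hY, hprod⟩ := ih (f := fun j => f j.succ) hi
        fun j hj => hf _ fun h => hj (Fin.succ_injective _ h)
      have h0 := hf 0 (Fin.succ_ne_zero i).symm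
      refine ⟨f 0 * Y, mul_mem h0 hY, ?_⟩
      rw [hprod, ← mul_assoc, ← (commute_of_mem_opsOn_of_mem_opsOff hi h0).eq, mul_assoc]

theorem opNorm_one_le {ι : Type*} [Fintype ι] [DecidableEq ι] :
    opNorm (1 : Matrix ι ι ℂ) ≤ 1 := by
  rw [opNorm, map_one]
  exact ContinuousLinearMap.norm_id_le

open scoped Matrix.Norms.L2Operator in
theorem opNorm_list_prod_le {ι : Type*} [Fintype ι] [DecidableEq ι] {B : ℝ} (hB : 0 ≤ B) {r : ℕ}
    {f : Fin r → Matrix ι ι ℂ} (hf : ∀ i, opNorm (f i) ≤ B) :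
    opNorm (List.ofFn f).prod ≤ B ^ r := by
  induction r with
  | zero => simpa using opNorm_one_le
  | succ r ih =>
    rw [List.ofFn_succ, List.prod_cons, pow_succ']
    have h0 := hf 0
    have h1 := ih fun i => hf i.succ
    rw [opNorm_eq_l2] at h0 h1 ⊢
    exact (norm_mul_le _ _).trans (mul_le_mul h0 h1 (norm_nonneg _) hB)

/-- Words containing an isolated letter have zero expectation, so the moments of a sum of centred
local terms are controlled by the number of clustered words. -/
theorem norm_trace_sum_pow_le {α : Type*} [Fintype α] [DecidableEq α] {R : α → α → Prop}
    [DecidableRel R] (hrefl : ∀ a, R a a) (hsymm : ∀ a b, R a b → R b a) {m : ℕ} (hm1 : 1 ≤ m)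
    (hm : ∀ a, (Finset.univ.filter (R a)).card ≤ m + 1)
    {ρs : C → Matrix (Fin d) (Fin d) ℂ} (hρs : ∀ s, (ρs s).PosSemidef ∧ (ρs s).trace = 1)
    {S : α → Finset C} {g : α → Matrix (C → Fin d) (C → Fin d) ℂ}
    (hon : ∀ a, g a ∈ opsOn d (S a)) (hoff : ∀ a b, ¬ R a b → g b ∈ opsOff d (S a))
    (hmean : ∀ a, (prodMatrix ρs * g a).trace = 0) {B : ℝ} (hB : 0 ≤ B)
    (hg : ∀ a, opNorm (g a) ≤ B) (r : ℕ) :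
    ‖(prodMatrix ρs * (∑ a, g a) ^ r).trace‖ ≤
      wordBound m (Fintype.card α * (m + 1)) r 0 * B ^ r := by
  classical
  have hρ := posSemidef_prodMatrix fun s => (hρs s).1
  have htr : (prodMatrix ρs).trace = 1 := by simp [trace_prodMatrix, hρs]
  have hword (l : Fin r → α) :
      ‖(prodMatrix ρs * (List.ofFn fun i => g (l i)).prod).trace‖ ≤ B ^ r :=
    (norm_trace_mul_le_opNorm hρ htr _).trans
      (opNorm_list_prod_le (f := fun i => g (l i)) hB fun i => hg (l i))
  rw [sum_pow_eq_sum_words, Finset.mul_sum, Matrix.trace_sum,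
    ← Finset.sum_filter_of_ne (p := fun l => Clustered R ∅ l)]
  · refine (norm_sum_le_of_le _ fun l _ => hword l).trans ?_
    rw [Finset.sum_const, nsmul_eq_mul]
    gcongr
    exact card_clustered_le hrefl hsymm hm1 hm r 0 ∅ (by simp)
  · intro l _ hne
    by_contra hl
    simp only [Clustered, not_forall, not_or, not_exists, not_and] at hl
    obtain ⟨i, -, hi⟩ := hl
    obtain ⟨Y, hY, hprod⟩ := exists_prod_ofFn_eq_mul (f := fun j => g (l j)) (hon (l i))
      fun j hj => hoff _ _ (hi j hj)
    apply hne
    rw [hprod, trace_prodMatrix_mul_mul (fun s => (hρs s).2) (hon (l i)) hY, hmean, zero_mul]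

theorem sum_mul_exp_le_of_moments {ι : Type*} [Fintype ι] {p x : ι → ℝ} {m K : ℕ} {B : ℝ}
    (hB : 0 ≤ B) (hmom : ∀ r, ∑ i, p i * x i ^ r ≤ wordBound m K r 0 * B ^ r) {t : ℝ} (ht : 0 ≤ t)
    (hmt : m * (B * t) ≤ 3 / 10) :
    ∑ i, p i * Real.exp (t * x i) ≤
      Real.exp (10 / 17 * K * ((B * t) ^ 2 / (1 - m * (B * t)))) := by
  have hsum : HasSum (fun r : ℕ => t ^ r / r.factorial * ∑ i, p i * x i ^ r)
      (∑ i, p i * Real.exp (t * x i)) := by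
    have hexp (i : ι) : HasSum (fun r : ℕ => p i * ((t * x i) ^ r / r.factorial))
        (p i * Real.exp (t * x i)) := by
      rw [Real.exp_eq_exp_ℝ]
      exact (NormedSpace.expSeries_div_hasSum_exp (t * x i)).mul_left _
    convert! hasSum_sum fun i (_ : i ∈ Finset.univ) => hexp i using 1
    funext r
    rw [Finset.mul_sum]
    refine Finset.sum_congr rfl fun i _ => ?_
    rw [mul_pow]
    ring
  refine le_of_tendsto' hsum.tendsto_sum_nat fun N => ?_
  refine le_trans (Finset.sum_le_sum fun r _ => ?_)
    ((wordBound_sum_le m K hmt N 0 (B * t) ⟨by positivity, le_rfl⟩).trans (by simp))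
  calc t ^ r / r.factorial * ∑ i, p i * x i ^ r
      ≤ t ^ r / r.factorial * (wordBound m K r 0 * B ^ r) := by
        gcongr
        exact hmom r
    _ = wordBound m K r 0 * (B * t) ^ r / r.factorial := by
        rw [mul_pow]
        ring

end Moments

section Matching

theorem sum_mul_exp_le_of_abs_le {ι : Type*} [Fintype ι] {p x : ι → ℝ} (hp : ∀ i, 0 ≤ p i)
    (hsum : ∑ i, p i = 1) {k : ℝ} (hx : ∀ i, |x i| ≤ k) (t : ℝ) :
    ∑ i, p i * Real.exp (t * x i) ≤
      Real.exp (t * ∑ i, p i * x i + t ^ 2 * k ^ 2 / 2) := by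
  let _ : MeasurableSpace ι := ⊤
  let P : PMF ι := PMF.ofFintype (fun i => ENNReal.ofReal (p i))
    (by rw [← ENNReal.ofReal_sum_of_nonneg fun i _ => hp i, hsum, ENNReal.ofReal_one])
  have hP (f : ι → ℝ) : ∫ i, f i ∂P.toMeasure = ∑ i, p i * f i := by
    rw [PMF.integral_eq_sum]
    exact Finset.sum_congr rfl fun i _ => by simp [P, ENNReal.toReal_ofReal (hp i)]
  have hmgf := (ProbabilityTheory.hasSubgaussianMGF_of_mem_Icc (μ := P.toMeasure) (X := x)
    (a := -k) (b := k) measurable_from_top.aemeasurable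
    (Filter.Eventually.of_forall fun i => abs_le.mp (hx i))).mgf_le t
  rw [ProbabilityTheory.mgf, hP, hP] at hmgf
  have hk : ((((‖k - -k‖₊ / 2) ^ 2 : NNReal)) : ℝ) = k ^ 2 := by
    push_cast
    rw [Real.norm_eq_abs, div_pow, sq_abs]
    ring
  rw [hk] at hmgf
  calc ∑ i, p i * Real.exp (t * x i)
      = Real.exp (t * ∑ i, p i * x i) *
          ∑ i, p i * Real.exp (t * (x i - ∑ i, p i * x i)) := by
        rw [Finset.mul_sum]
        refine Finset.sum_congr rfl fun i _ => ?_
        rw [mul_left_comm, ← Real.exp_add]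
        ring_nf
    _ ≤ Real.exp (t * ∑ i, p i * x i) * Real.exp (k ^ 2 * t ^ 2 / 2) := by gcongr
    _ = _ := by
        rw [← Real.exp_add]
        ring_nf

theorem trace_mul_exp_smul {ι : Type*} [Fintype ι] [DecidableEq ι] {ρ A : Matrix ι ι ℂ}
    (hA : A.IsHermitian) {p : ι → ℝ}
    (hp : ∀ f : ι → ℂ, (ρ * eigenDiagonal hA f).trace = ∑ i, (p i : ℂ) * f i) (t : ℝ) :
    (ρ * NormedSpace.exp ((t : ℂ) • A)).trace =
      ((∑ i, p i * Real.exp (t * hA.eigenvalues i) : ℝ) : ℂ) := by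
  have hsmul : (t : ℂ) • A = eigenDiagonal hA (fun i => (t : ℂ) * (hA.eigenvalues i : ℂ)) := by
    conv_lhs => rw [← eigenDiagonal_eigenvalues hA]
    have hd : Matrix.diagonal (fun i => (t : ℂ) * (hA.eigenvalues i : ℂ)) =
        (t : ℂ) • Matrix.diagonal (fun i => (hA.eigenvalues i : ℂ)) := by
      ext i j
      by_cases h : i = j <;> simp [h]
    rw [eigenDiagonal, eigenDiagonal, hd, Matrix.mul_smul, Matrix.smul_mul]
  rw [hsmul, exp_eigenDiagonal, hp]
  push_cast
  rfl

theorem re_trace_mul_eq_sum {ι : Type*} [Fintype ι] [DecidableEq ι] {ρ A : Matrix ι ι ℂ}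
    (hA : A.IsHermitian) {p : ι → ℝ}
    (hp : ∀ f : ι → ℂ, (ρ * eigenDiagonal hA f).trace = ∑ i, (p i : ℂ) * f i) :
    (ρ * A).trace = ((∑ i, p i * hA.eigenvalues i : ℝ) : ℂ) := by
  conv_lhs => rw [← eigenDiagonal_eigenvalues hA]
  rw [hp]
  push_cast
  rfl

open scoped Matrix.Norms.L2Operator in
theorem opNorm_sum_le {ι β : Type*} [Fintype ι] [DecidableEq ι] {s : Finset β}
    {f : β → Matrix ι ι ℂ} (hf : ∀ w ∈ s, opNorm (f w) ≤ 1) :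
    opNorm (∑ w ∈ s, f w) ≤ s.card := by
  simp only [opNorm_eq_l2] at hf ⊢
  simpa using norm_sum_le_of_le s hf

theorem isHermitian_sum {ι β : Type*} {s : Finset β} {f : β → Matrix ι ι ℂ}
    (hf : ∀ w ∈ s, (f w).IsHermitian) : (∑ w ∈ s, f w).IsHermitian := by
  rw [Matrix.IsHermitian, Matrix.conjTranspose_sum]
  exact Finset.sum_congr rfl hf

/-- When the intersection graph of the supports is a matching, the moment generating function
factorizes over the edges. -/
theorem trace_exp_sum_le_of_matching {ρs : C → Matrix (Fin d) (Fin d) ℂ}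
    (hρs : ∀ s, (ρs s).PosSemidef ∧ (ρs s).trace = 1)
    (h : Finset C → Matrix (C → Fin d) (C → Fin d) ℂ) (t : ℝ) (U : Finset (Finset C))
    (hm : ∀ w ∈ U, (U.filter (fun w' => w' ≠ w ∧ (w ∩ w').Nonempty)).card ≤ 1)
    (hsupp : ∀ w ∈ U, SupportedOn w (h w)) (hherm : ∀ w ∈ U, (h w).IsHermitian)
    (hnorm : ∀ w ∈ U, opNorm (h w) ≤ 1) :
    ∃ r : ℝ, 0 ≤ r ∧
      (prodMatrix ρs * NormedSpace.exp ((t : ℂ) • ∑ w ∈ U, h w)).trace = (r : ℂ) ∧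
      r ≤ Real.exp (t * (prodMatrix ρs * ∑ w ∈ U, h w).trace.re + U.card * t ^ 2) := by
  have hρ := posSemidef_prodMatrix fun s => (hρs s).1
  have htr : (prodMatrix ρs).trace = 1 := by simp [trace_prodMatrix, hρs]
  induction U using Finset.strongInduction with
  | H U ih =>
  rcases U.eq_empty_or_nonempty with rfl | ⟨w, hw⟩
  · exact ⟨1, zero_le_one, by simp [NormedSpace.exp_zero, htr], by simp⟩
  set N := insert w (U.filter fun w' => w' ≠ w ∧ (w ∩ w').Nonempty) with hN
  have hNU : N ⊆ U := Finset.insert_subset hw (Finset.filter_subset _ _)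
  have hNcard : N.card ≤ 2 := (Finset.card_insert_le _ _).trans (by linarith [hm w hw])
  have hdisj : ∀ v ∈ U \ N, ∀ u ∈ N, Disjoint v u := by
    intro v hv u hu
    obtain ⟨hvU, hvN⟩ := Finset.mem_sdiff.mp hv
    have hvw : v ≠ w := fun h => hvN (h ▸ Finset.mem_insert_self _ _)
    rw [Finset.disjoint_iff_inter_eq_empty]
    by_contra hne
    have hne' := Finset.nonempty_iff_ne_empty.mpr hne
    rcases Finset.mem_insert.mp hu with rfl | hu'
    · exact hvN (Finset.mem_insert_of_mem (Finset.mem_filter.mpr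
        ⟨hvU, hvw, by rwa [Finset.inter_comm]⟩))
    · obtain ⟨huU, huw, hwu⟩ := Finset.mem_filter.mp hu'
      refine hvw (Finset.card_le_one.mp (hm u huU) v ?_ w ?_)
      · exact Finset.mem_filter.mpr ⟨hvU, fun h => hvN (h ▸ hu), by rwa [Finset.inter_comm]⟩
      · exact Finset.mem_filter.mpr ⟨hw, huw.symm, by rwa [Finset.inter_comm]⟩
  have hX : (t : ℂ) • ∑ u ∈ N, h u ∈ opsOn d (N.biUnion id) :=
    Subalgebra.smul_mem _ (sum_mem fun u hu =>
      ((hsupp u (hNU hu)).mono (Finset.subset_biUnion_of_mem id hu)).mem_opsOn) _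
  have hY : (t : ℂ) • ∑ v ∈ U \ N, h v ∈ opsOff d (N.biUnion id) :=
    Subalgebra.smul_mem _ (sum_mem fun v hv => (hsupp v (Finset.sdiff_subset hv)).mem_opsOff
      ((Finset.disjoint_biUnion_right _ _ _).mpr fun u hu => hdisj v hv u hu)) _
  obtain ⟨r, hr0, hr, hrle⟩ := ih (U \ N)
    (Finset.sdiff_ssubset hNU ⟨w, Finset.mem_insert_self _ _⟩)
    (fun v hv => (Finset.card_le_card (Finset.filter_subset_filter _ Finset.sdiff_subset)).trans
      (hm v (Finset.sdiff_subset hv)))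
    (fun v hv => hsupp v (Finset.sdiff_subset hv)) (fun v hv => hherm v (Finset.sdiff_subset hv))
    (fun v hv => hnorm v (Finset.sdiff_subset hv))
  have hHN := isHermitian_sum fun u hu => hherm u (hNU hu)
  obtain ⟨p, hp0, hp1, hp⟩ := exists_eigen_distribution hρ htr hHN
  have hle := sum_mul_exp_le_of_abs_le hp0 hp1 (fun i => (abs_eigenvalues_le_opNorm hHN i).trans
    (opNorm_sum_le fun u hu => hnorm u (hNU hu))) t
  have hsplit : ∑ u ∈ U, h u = ∑ u ∈ N, h u + ∑ v ∈ U \ N, h v := by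
    rw [add_comm, Finset.sum_sdiff hNU]
  have hcard : (U.card : ℝ) = N.card + (U \ N).card := by
    rw [← Nat.cast_add, add_comm, Finset.card_sdiff_add_card_eq_card hNU]
  refine ⟨(∑ i, p i * Real.exp (t * hHN.eigenvalues i)) * r, ?_, ?_, ?_⟩
  · exact mul_nonneg (Finset.sum_nonneg fun i _ => mul_nonneg (hp0 i) (Real.exp_nonneg _)) hr0
  · rw [hsplit, smul_add, Matrix.exp_add_of_commute _ _ (commute_of_mem_opsOn_of_mem_opsOff hX hY),
      trace_prodMatrix_mul_mul (fun s => (hρs s).2)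
        (NormedSpace.exp_mem (R := ℂ) (isClosed_opsOn _) hX)
        (NormedSpace.exp_mem (R := ℂ) (isClosed_opsOff _) hY), hr, trace_mul_exp_smul hHN hp]
    push_cast
    rfl
  · refine (mul_le_mul hle hrle hr0 (Real.exp_nonneg _)).trans ?_
    rw [← Real.exp_add, Real.exp_le_exp, hsplit, Matrix.mul_add, Matrix.trace_add, Complex.add_re,
      re_trace_mul_eq_sum hHN hp, Complex.ofReal_re, hcard]
    have hN2 : (N.card : ℝ) ≤ 2 := by exact_mod_cast hNcard
    have h3 : t ^ 2 * (N.card : ℝ) ^ 2 / 2 ≤ N.card * t ^ 2 := by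
      have := mul_le_mul_of_nonneg_left hN2 (mul_nonneg (sq_nonneg t) (Nat.cast_nonneg N.card))
      nlinarith
    linarith

end Matching

section Tail

theorem re_trace_projGE {ι : Type*} [Fintype ι] [DecidableEq ι] {ρ A : Matrix ι ι ℂ}
    (hA : A.IsHermitian) {p : ι → ℝ}
    (hp : ∀ f : ι → ℂ, (ρ * eigenDiagonal hA f).trace = ∑ i, (p i : ℂ) * f i) (x : ℝ) :
    (ρ * projGE hA x).trace.re = ∑ i, p i * if x ≤ hA.eigenvalues i then 1 else 0 := by
  have h : (ρ * projGE hA x).trace =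
      ((∑ i, p i * if x ≤ hA.eigenvalues i then 1 else 0 : ℝ) : ℂ) := by
    refine (hp _).trans ?_
    push_cast
    exact Finset.sum_congr rfl fun i _ => by split_ifs <;> simp
  rw [h, Complex.ofReal_re]

theorem sum_mul_indicator_le_exp {ι : Type*} [Fintype ι] {p l : ι → ℝ} (hp : ∀ i, 0 ≤ p i)
    {t : ℝ} (ht : 0 ≤ t) (x : ℝ) :
    ∑ i, p i * (if x ≤ l i then 1 else 0) ≤ ∑ i, p i * Real.exp (t * (l i - x)) := by
  refine Finset.sum_le_sum fun i _ => mul_le_mul_of_nonneg_left ?_ (hp i)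
  split_ifs with h
  · exact Real.one_le_exp (mul_nonneg ht (sub_nonneg.mpr h))
  · exact Real.exp_nonneg _

/-- Bound on the moment generating function of the energy in a product state. -/
theorem sum_mul_exp_eigenvalues_le {W : Finset (Finset C)} {m : ℕ} (hm1 : 1 ≤ m)
    (hm : ∀ w ∈ W, (W.filter (fun w' => w' ≠ w ∧ (w ∩ w').Nonempty)).card ≤ m)
    {h : Finset C → Matrix (C → Fin d) (C → Fin d) ℂ}
    (hsupp : ∀ w ∈ W, SupportedOn w (h w)) (hnorm : ∀ w ∈ W, opNorm (h w) ≤ 1)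
    {ρs : C → Matrix (Fin d) (Fin d) ℂ} (hρs : ∀ s, (ρs s).PosSemidef ∧ (ρs s).trace = 1)
    (hH : (∑ w ∈ W, h w).IsHermitian) {p : (C → Fin d) → ℝ}
    (hp : ∀ f : (C → Fin d) → ℂ,
      (prodMatrix ρs * eigenDiagonal hH f).trace = ∑ i, (p i : ℂ) * f i)
    {t : ℝ} (ht : 0 ≤ t) (hmt : m * (2 * t) ≤ 3 / 10) :
    ∑ i, p i * Real.exp (t * (hH.eigenvalues i - ∑ j, p j * hH.eigenvalues j)) ≤
      Real.exp (10 / 17 * (W.card * (m + 1)) * ((2 * t) ^ 2 / (1 - m * (2 * t)))) := by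
  have hρ := posSemidef_prodMatrix fun s => (hρs s).1
  have htr : (prodMatrix ρs).trace = 1 := by simp [trace_prodMatrix, hρs]
  set μ := ∑ j, p j * hH.eigenvalues j with hμ
  let R : {w // w ∈ W} → {w // w ∈ W} → Prop := fun v w => v = w ∨ (v.1 ∩ w.1).Nonempty
  let g : {w // w ∈ W} → Matrix (C → Fin d) (C → Fin d) ℂ :=
    fun w => h w - (prodMatrix ρs * h w).trace • 1
  have hcard (v : {w // w ∈ W}) : (Finset.univ.filter (R v)).card ≤ m + 1 := by
    refine le_trans ?_ ((Finset.card_insert_le v.1 _).trans (Nat.succ_le_succ (hm v.1 v.2)))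
    refine Finset.card_le_card_of_injOn Subtype.val (fun w hw => ?_)
      (Subtype.val_injective.injOn)
    by_cases hwv : w = v
    · simp [hwv]
    · have hw' : v = w ∨ (v.1 ∩ w.1).Nonempty := (Finset.mem_filter.mp hw).2
      exact Finset.mem_coe.mpr (Finset.mem_insert_of_mem (Finset.mem_filter.mpr
        ⟨w.2, fun h => hwv (Subtype.ext h), hw'.resolve_left fun h => hwv h.symm⟩))
  have hscalar (w : Finset C) (c : ℂ) :
      c • (1 : Matrix (C → Fin d) (C → Fin d) ℂ) ∈ opsOn d w ⊓ opsOff d w :=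
    Subalgebra.smul_mem _ (one_mem _) c
  have hgnorm (w : {w // w ∈ W}) : opNorm (g w) ≤ 2 := by
    have h1 := hnorm w.1 w.2
    have h2 := (norm_trace_mul_le_opNorm hρ htr (h w.1)).trans h1
    have h3 := opNorm_one_le (ι := C → Fin d)
    have h4 : opNorm (g w) ≤ opNorm (h w.1) +
        ‖(prodMatrix ρs * h w.1).trace‖ * opNorm (1 : Matrix (C → Fin d) (C → Fin d) ℂ) := by
      simp only [opNorm, g, map_sub, map_smul]
      exact (norm_sub_le _ _).trans (by rw [norm_smul])
    nlinarith [norm_nonneg (prodMatrix ρs * h w.1).trace]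
  have hsum : ∑ w, g w = eigenDiagonal hH (fun i => ((hH.eigenvalues i - μ : ℝ) : ℂ)) := by
    have h1 : (fun i => ((hH.eigenvalues i - μ : ℝ) : ℂ)) =
        (fun i => (hH.eigenvalues i : ℂ)) - fun _ => (μ : ℂ) := by
      ext i
      simp
    rw [h1, eigenDiagonal_sub, eigenDiagonal_eigenvalues, eigenDiagonal_const, hμ,
      ← re_trace_mul_eq_sum hH hp, Matrix.mul_sum, Matrix.trace_sum, Finset.sum_smul,
      ← Finset.sum_sub_distrib]
    exact Finset.sum_coe_sort W fun w => h w - (prodMatrix ρs * h w).trace • 1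
  have hmom (r : ℕ) : ∑ i, p i * (hH.eigenvalues i - μ) ^ r ≤
      wordBound m (W.card * (m + 1)) r 0 * 2 ^ r := by
    have hbound := norm_trace_sum_pow_le (R := R) (S := fun w => w.1) (g := g) (m := m) (B := 2)
      (fun w => Or.inl rfl)
      (fun v w hvw => hvw.imp Eq.symm fun h => by rwa [Finset.inter_comm]) hm1 hcard hρs
      (fun w => sub_mem (hsupp w.1 w.2).mem_opsOn (hscalar _ _).1)
      (fun v w hvw => sub_mem ((hsupp w.1 w.2).mem_opsOff (Finset.disjoint_iff_inter_eq_empty.mpr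
        (Finset.not_nonempty_iff_eq_empty.mp fun h =>
          hvw (Or.inr (by rwa [Finset.inter_comm]))))) (hscalar _ _).2)
      (fun w => by simp [g, Matrix.mul_sub, htr]) zero_le_two hgnorm r
    have heq : (prodMatrix ρs * (∑ w, g w) ^ r).trace =
        ((∑ i, p i * (hH.eigenvalues i - μ) ^ r : ℝ) : ℂ) := by
      rw [hsum, eigenDiagonal_pow, hp]
      push_cast
      rfl
    rw [heq, Complex.norm_real, Fintype.card_coe] at hbound
    exact (le_abs_self _).trans hbound
  have := sum_mul_exp_le_of_moments zero_le_two hmom ht hmt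
  push_cast at this
  exact this

theorem chernoff_exponent_le {m n a : ℝ} (hm : 2 ≤ m) (hn : 0 ≤ n) (ha2 : a ≤ 2) :
    -(3 * a / (40 * m)) * (n * a) + 10 / 17 * (n * (m + 1)) *
        ((2 * (3 * a / (40 * m))) ^ 2 / (1 - m * (2 * (3 * a / (40 * m))))) ≤
      -(n * a ^ 2) / (4 * Real.exp 1 * m ^ 2) := by
  have hm0 : 0 < m := by linarith
  have he := Real.exp_one_gt_d9
  have hmt : m * (2 * (3 * a / (40 * m))) = 3 * a / 20 := by
    field_simp
    ring
  have h1 : (2 * (3 * a / (40 * m))) ^ 2 / (1 - m * (2 * (3 * a / (40 * m)))) ≤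
      (2 * (3 * a / (40 * m))) ^ 2 / (7 / 10) := by
    rw [hmt]
    gcongr
    linarith
  have h2 : (4 * Real.exp 1)⁻¹ ≤ 0.0925 := by
    rw [inv_le_comm₀ (by positivity) (by norm_num)]
    norm_num
    linarith
  have h3 : -(3 / 40 * m) + 10 / 17 * (m + 1) * (9 / 280) ≤ -(4 * Real.exp 1)⁻¹ := by linarith
  calc _ ≤ -(3 * a / (40 * m)) * (n * a) + 10 / 17 * (n * (m + 1)) *
        ((2 * (3 * a / (40 * m))) ^ 2 / (7 / 10)) := by gcongr
    _ = n * a ^ 2 / m ^ 2 * (-(3 / 40 * m) + 10 / 17 * (m + 1) * (9 / 280)) := by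
      field_simp
      ring
    _ ≤ n * a ^ 2 / m ^ 2 * -(4 * Real.exp 1)⁻¹ := by gcongr
    _ = _ := by
      field_simp

end Tail

/-- Theorem 5.3, upper tail (quantum Chernoff bound for product states):
for `a ≥ √(8em²/n)`, `Tr(ρ Π_{≥ ⟨H⟩_ρ + na}) ≤ exp(−na²/(4em²))`. -/
theorem product_state_upper_tail {C : Type*} [Fintype C] [DecidableEq C] {d : ℕ}
    (W : Finset (Finset C)) (n : ℕ) (hn : W.card = n) (hnpos : 0 < n) (m : ℕ)
    (hm : ∀ w ∈ W, (W.filter (fun w' => w' ≠ w ∧ (w ∩ w').Nonempty)).card ≤ m)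
    (h : Finset C → Matrix (C → Fin d) (C → Fin d) ℂ)
    (hsupp : ∀ w ∈ W, SupportedOn w (h w))
    (hherm : ∀ w ∈ W, (h w).IsHermitian)
    (hnorm : ∀ w ∈ W, opNorm (h w) ≤ 1)
    (ρs : C → Matrix (Fin d) (Fin d) ℂ)
    (hρs : ∀ s, (ρs s).PosSemidef ∧ (ρs s).trace = 1)
    (hH : (∑ w ∈ W, h w).IsHermitian)
    (a : ℝ) (ha : Real.sqrt (8 * Real.exp 1 * m ^ 2 / n) ≤ a) :
    (Matrix.trace (prodMatrix ρs *
        projGE hH ((Matrix.trace (prodMatrix ρs * ∑ w ∈ W, h w)).re + n * a))).re ≤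
      Real.exp (-(n * a ^ 2) / (4 * Real.exp 1 * m ^ 2)) := by
  have hρ := posSemidef_prodMatrix fun s => (hρs s).1
  have htr : (prodMatrix ρs).trace = 1 := by simp [trace_prodMatrix, hρs]
  have ha0 : 0 ≤ a := (Real.sqrt_nonneg _).trans ha
  have hn0 : (0 : ℝ) < n := Nat.cast_pos.mpr hnpos
  obtain ⟨p, hp0, hp1, hp⟩ := exists_eigen_distribution hρ htr hH
  set μ := (prodMatrix ρs * ∑ w ∈ W, h w).trace.re with hμdef
  have hμ : μ = ∑ i, p i * hH.eigenvalues i := by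
    rw [hμdef, re_trace_mul_eq_sum hH hp, Complex.ofReal_re]
  rw [re_trace_projGE hH hp]
  have hmarkov {t : ℝ} (ht : 0 ≤ t) :=
    sum_mul_indicator_le_exp (l := hH.eigenvalues) hp0 ht (μ + n * a)
  rcases Nat.lt_or_ge m 2 with hm2 | hm2
  · interval_cases m
    · simpa [hp1] using hmarkov le_rfl
    · obtain ⟨r, -, hr, hrle⟩ := trace_exp_sum_le_of_matching hρs h (a / 2) W hm hsupp hherm hnorm
      rw [trace_mul_exp_smul hH hp, Complex.ofReal_inj] at hr
      rw [← hr, hn] at hrle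
      refine (hmarkov (t := a / 2) (by positivity)).trans ?_
      calc ∑ i, p i * Real.exp (a / 2 * (hH.eigenvalues i - (μ + n * a)))
          = Real.exp (-(a / 2 * (μ + n * a))) *
              ∑ i, p i * Real.exp (a / 2 * hH.eigenvalues i) := by
            rw [Finset.mul_sum]
            refine Finset.sum_congr rfl fun i _ => ?_
            rw [mul_left_comm, ← Real.exp_add]
            ring_nf
        _ ≤ Real.exp (-(a / 2 * (μ + n * a))) * Real.exp (a / 2 * μ + n * (a / 2) ^ 2) := by
            gcongr
        _ = Real.exp (-(n * a ^ 2) / 4) := by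
            rw [← Real.exp_add]
            ring_nf
        _ ≤ _ := by
            rw [Real.exp_le_exp, neg_div, neg_div, neg_le_neg_iff]
            have := Real.add_one_le_exp 1
            refine div_le_div_of_nonneg_left (by positivity) (by norm_num) ?_
            push_cast
            linarith
  · rcases le_or_gt a 2 with ha2 | ha2
    · have hm2' : (2 : ℝ) ≤ m := by exact_mod_cast hm2
      have ht : 0 ≤ 3 * a / (40 * (m : ℝ)) := by positivity
      have hmt : m * (2 * (3 * a / (40 * (m : ℝ)))) ≤ 3 / 10 := by
        have : m * (2 * (3 * a / (40 * (m : ℝ)))) = 3 * a / 20 := by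
          field_simp
          ring
        linarith
      have hmgf := sum_mul_exp_eigenvalues_le (by omega) hm hsupp hnorm hρs hH hp ht hmt
      rw [← hμ, hn] at hmgf
      refine (hmarkov ht).trans ?_
      calc ∑ i, p i * Real.exp (3 * a / (40 * m) * (hH.eigenvalues i - (μ + n * a)))
          = Real.exp (-(3 * a / (40 * m)) * (n * a)) *
              ∑ i, p i * Real.exp (3 * a / (40 * m) * (hH.eigenvalues i - μ)) := by
            rw [Finset.mul_sum]
            refine Finset.sum_congr rfl fun i _ => ?_
            rw [mul_left_comm, ← Real.exp_add]
            ring_nf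
        _ ≤ _ := by
            refine (mul_le_mul_of_nonneg_left hmgf (Real.exp_nonneg _)).trans ?_
            rw [← Real.exp_add, Real.exp_le_exp]
            exact chernoff_exponent_le hm2' hn0.le ha2
    · have hnormH : opNorm (∑ w ∈ W, h w) ≤ n := hn ▸ opNorm_sum_le hnorm
      have hμle : |μ| ≤ n := (Complex.abs_re_le_norm _).trans
        ((norm_trace_mul_le_opNorm hρ htr _).trans hnormH)
      refine le_of_eq_of_le (Finset.sum_eq_zero fun i _ => ?_) (Real.exp_nonneg _)
      have hi := (abs_le.mp ((abs_eigenvalues_le_opNorm hH i).trans hnormH)).2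
      rw [if_neg, mul_zero]
      nlinarith [(abs_le.mp hμle).1]
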